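/- Let 0 < α < 1, h ≥ 0, T > 0, let f : [0,T] × ℝ × ℝ → ℝ be continuous, let g : [0,T] → [−h,T] be continuous with g(t) ≤ t for all t ∈ [0,T], and assume there is a constant L > 0 such that |f(t,υ₁,ϑ₁) − f(t,υ₂,ϑ₂)| ≤ L(|υ₁ − υ₂| + |ϑ₁ − ϑ₂|) for all υ₁,υ₂,ϑ₁,ϑ₂ ∈ ℝ and t ∈ [0,T]. Then there exists a constant c > 0 such that: for every ε > 0 and every continuous function ϑ : [−h,T] → ℝ satisfying |ϑ(t) − ϑ(0) − (1/Γ(α)) ∫₀ᵗ (t−s)^{α−1} f(s, ϑ(s), ϑ(g(s))) ds| ≤ ε T^α / Γ(α+1) for all t ∈ [0,T], there exists a continuous function υ : [−h,T] → ℝ with υ = ϑ on [−h,0], satisfying υ(t) = ϑ(0) + (1/Γ(α)) ∫₀ᵗ (t−s)^{α−1} f(s, υ(s), υ(g(s))) ds for all t ∈ [0,T], and |ϑ(t) − υ(t)| ≤ cε for all t ∈ [−h,T]. -/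

import Mathlib

open Real Set

open MeasureTheory

/-- The Riemann–Liouville fractional integral of order `α` based at `0`. -/
noncomputable def riemannLiouville (α : ℝ) (φ : ℝ → ℝ) (t : ℝ) : ℝ :=
  (1 / Real.Gamma α) * ∫ s in (0:ℝ)..t, (t - s) ^ (α - 1) * φ s

theorem intervalIntegrable_sub_rpow {α : ℝ} (hα : 0 < α) (t : ℝ) :
    IntervalIntegrable (fun s => (t - s) ^ (α - 1)) volume 0 t := by
  have := (intervalIntegral.intervalIntegrable_rpow' (a := t) (b := 0)
    (show -1 < α - 1 by linarith)).comp_sub_left t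
  simpa using this

theorem intervalIntegrable_sub_rpow_mul {α t : ℝ} (hα : 0 < α) (ht : 0 ≤ t) {φ : ℝ → ℝ}
    (hφ : ContinuousOn φ (Icc 0 t)) :
    IntervalIntegrable (fun s => (t - s) ^ (α - 1) * φ s) volume 0 t :=
  (intervalIntegrable_sub_rpow hα t).mul_continuousOn (by rwa [uIcc_of_le ht])

theorem integral_sub_rpow_mul_eq_rpow_mul {α t : ℝ} (hα : 0 < α) (ht : 0 ≤ t) (φ : ℝ → ℝ) :
    ∫ s in (0:ℝ)..t, (t - s) ^ (α - 1) * φ s =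
      t ^ α * ∫ x in (0:ℝ)..1, (1 - x) ^ (α - 1) * φ (t * x) := by
  rcases ht.eq_or_lt with rfl | ht
  · simp [Real.zero_rpow hα.ne']
  have h := intervalIntegral.smul_integral_comp_mul_left
    (fun s : ℝ => (t - s) ^ (α - 1) * φ s) (a := 0) (b := 1) t
  rw [mul_zero, mul_one] at h
  rw [← h, smul_eq_mul, show t ^ α = t * t ^ (α - 1) by
    rw [Real.rpow_sub_one ht.ne']; field_simp, mul_assoc]
  congr 1
  rw [← intervalIntegral.integral_const_mul]
  refine intervalIntegral.integral_congr fun x hx => ?_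
  rw [uIcc_of_le zero_le_one] at hx
  rw [show t - t * x = t * (1 - x) by ring, Real.mul_rpow ht.le (by linarith [hx.2]), mul_assoc]

theorem continuousOn_riemannLiouville {α T : ℝ} (hα : 0 < α) (hT : 0 ≤ T) {φ : ℝ → ℝ}
    (hφ : ContinuousOn φ (Icc 0 T)) : ContinuousOn (riemannLiouville α φ) (Icc 0 T) := by
  let ψ : ℝ → ℝ := IccExtend hT ((Icc 0 T).domRestrict φ)
  have hψc : Continuous ψ := hφ.domRestrict.Icc_extend'
  obtain ⟨C, hC⟩ := isCompact_Icc.exists_bound_of_continuousOn hφ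
  have hψb : ∀ x, ‖ψ x‖ ≤ C := fun x => hC _ (projIcc 0 T hT x).2
  have hcont : Continuous fun t => (1 / Real.Gamma α) *
      (t ^ α * ∫ x in (0:ℝ)..1, (1 - x) ^ (α - 1) * ψ (t * x)) := by
    refine continuous_const.mul ((Real.continuous_rpow_const hα.le).mul ?_)
    have hint := intervalIntegrable_sub_rpow hα 1
    refine intervalIntegral.continuous_of_dominated_interval
      (bound := fun x => ‖(1 - x) ^ (α - 1)‖ * C) (fun t => ?_) (fun t => ?_)
      (hint.norm.mul_const C) ?_
    · have := hint.mul_continuousOn (g := fun x => ψ (t * x))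
        (hψc.comp (continuous_const.mul continuous_id)).continuousOn
      exact this.def'.aestronglyMeasurable
    · refine Filter.Eventually.of_forall fun x _ => ?_
      rw [norm_mul]
      exact mul_le_mul_of_nonneg_left (hψb _) (norm_nonneg _)
    · refine Filter.Eventually.of_forall fun x _ => ?_
      fun_prop
  refine hcont.continuousOn.congr fun t ht => ?_
  simp only [riemannLiouville]
  rw [← integral_sub_rpow_mul_eq_rpow_mul hα ht.1]
  congr 1
  refine intervalIntegral.integral_congr fun s hs => ?_
  rw [uIcc_of_le ht.1] at hs
  have hψs : ψ s = φ s := IccExtend_of_mem hT _ (Icc_subset_Icc_right ht.2 hs)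
  simp only [hψs]

theorem integral_sub_rpow_mul_exp_le {α l t : ℝ} (hα : 0 < α) (hl : 0 < l) (ht : 0 ≤ t) :
    ∫ s in (0:ℝ)..t, (t - s) ^ (α - 1) * Real.exp (l * s) ≤
      Real.exp (l * t) * ((1 / l) ^ α * Real.Gamma α) := by
  have hsub := intervalIntegral.integral_comp_sub_left
    (fun r => Real.exp (l * t) * (r ^ (α - 1) * Real.exp (-(l * r)))) (a := 0) (b := t) t
  have hΓ := Real.integral_rpow_mul_exp_neg_mul_Ioi hα hl
  have hint : IntegrableOn (fun r => r ^ (α - 1) * Real.exp (-(l * r))) (Ioi 0) := by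
    refine Integrable.of_integral_ne_zero ?_
    rw [hΓ]
    have := Real.Gamma_pos_of_pos hα
    positivity
  have heq : ∫ s in (0:ℝ)..t, (t - s) ^ (α - 1) * Real.exp (l * s) =
      Real.exp (l * t) * ∫ r in (0:ℝ)..t, r ^ (α - 1) * Real.exp (-(l * r)) := by
    rw [sub_self, sub_zero] at hsub
    rw [← intervalIntegral.integral_const_mul, ← hsub]
    refine intervalIntegral.integral_congr fun s _ => ?_
    rw [show l * s = l * t + -(l * (t - s)) by ring, Real.exp_add]
    ring
  rw [heq, ← hΓ, intervalIntegral.integral_of_le ht]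
  refine mul_le_mul_of_nonneg_left (setIntegral_mono_set hint ?_
    (LE.le.eventuallyLE Ioc_subset_Ioi_self)) (Real.exp_pos _).le
  refine (ae_restrict_iff' measurableSet_Ioi).2 (Filter.Eventually.of_forall fun r hr => ?_)
  have : (0:ℝ) < r := hr
  simp only [Pi.zero_apply]
  positivity

theorem abs_riemannLiouville_sub_le {α l t C : ℝ} (hα : 0 < α) (hl : 0 < l) (ht : 0 ≤ t)
    (hC : 0 ≤ C) {φ ψ : ℝ → ℝ} (hφ : ContinuousOn φ (Icc 0 t)) (hψ : ContinuousOn ψ (Icc 0 t))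
    (hle : ∀ s ∈ Icc 0 t, |φ s - ψ s| ≤ C * Real.exp (l * s)) :
    |riemannLiouville α φ t - riemannLiouville α ψ t| ≤
      C * (1 / l) ^ α * Real.exp (l * t) := by
  have hΓ := Real.Gamma_pos_of_pos hα
  have hbound : |∫ s in (0:ℝ)..t, ((t - s) ^ (α - 1) * φ s - (t - s) ^ (α - 1) * ψ s)| ≤
      ∫ s in (0:ℝ)..t, C * ((t - s) ^ (α - 1) * Real.exp (l * s)) := by
    rw [← Real.norm_eq_abs]
    refine intervalIntegral.norm_integral_le_of_norm_le ht
      (Filter.Eventually.of_forall fun s hs => ?_)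
      ((intervalIntegrable_sub_rpow_mul hα ht (by fun_prop)).const_mul C)
    have h0 : 0 ≤ (t - s) ^ (α - 1) := Real.rpow_nonneg (by linarith [hs.2]) _
    rw [← mul_sub, norm_mul, Real.norm_of_nonneg h0, Real.norm_eq_abs]
    calc _ ≤ (t - s) ^ (α - 1) * (C * Real.exp (l * s)) :=
          mul_le_mul_of_nonneg_left (hle s ⟨hs.1.le, hs.2⟩) h0
      _ = _ := by ring
  rw [intervalIntegral.integral_const_mul] at hbound
  rw [riemannLiouville, riemannLiouville, ← mul_sub, ← intervalIntegral.integral_sub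
    (intervalIntegrable_sub_rpow_mul hα ht hφ) (intervalIntegrable_sub_rpow_mul hα ht hψ),
    abs_mul, abs_of_pos (by positivity)]
  calc _ ≤ 1 / Real.Gamma α * (C * (Real.exp (l * t) * ((1 / l) ^ α * Real.Gamma α))) := by
        gcongr
        exact hbound.trans (by gcongr; exact integral_sub_rpow_mul_exp_le hα hl ht)
    _ = _ := by field_simp

/-- The perturbation of `θ` by `exp (l t) (z t - z 0)` on `[0, T]`; it agrees with `θ` on
`(-∞, 0]`. -/
noncomputable def expPerturb {T : ℝ} (hT : 0 ≤ T) (l : ℝ) (θ : ℝ → ℝ) (z : C(Icc (0:ℝ) T, ℝ))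
    (t : ℝ) : ℝ :=
  θ t + Real.exp (l * t) * (IccExtend hT z t - z ⟨0, left_mem_Icc.2 hT⟩)

section expPerturb

variable {T : ℝ} (hT : 0 ≤ T) (l : ℝ) (θ : ℝ → ℝ)

theorem ContinuousOn.expPerturb {θ : ℝ → ℝ} {s : Set ℝ} (hθ : ContinuousOn θ s)
    (z : C(Icc (0:ℝ) T, ℝ)) : ContinuousOn (expPerturb hT l θ z) s := by
  have : Continuous (IccExtend hT z) := z.continuous.Icc_extend'
  unfold _root_.expPerturb
  fun_prop

theorem expPerturb_of_nonpos (z : C(Icc (0:ℝ) T, ℝ)) {t : ℝ} (ht : t ≤ 0) :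
    expPerturb hT l θ z t = θ t := by
  simp [expPerturb, IccExtend_of_le_left hT z ht]

theorem expPerturb_zero : expPerturb hT l θ 0 = θ := by
  ext t
  simp [expPerturb, IccExtend]

theorem abs_expPerturb_sub_le (z w : C(Icc (0:ℝ) T, ℝ)) (t : ℝ) :
    |expPerturb hT l θ z t - expPerturb hT l θ w t| ≤ 2 * dist z w * Real.exp (l * t) := by
  have h1 := ContinuousMap.dist_apply_le_dist (f := z) (g := w) (projIcc 0 T hT t)
  have h2 := ContinuousMap.dist_apply_le_dist (f := z) (g := w) ⟨0, left_mem_Icc.2 hT⟩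
  rw [Real.dist_eq] at h1 h2
  rw [show expPerturb hT l θ z t - expPerturb hT l θ w t =
      ((z (projIcc 0 T hT t) - w (projIcc 0 T hT t)) -
        (z ⟨0, left_mem_Icc.2 hT⟩ - w ⟨0, left_mem_Icc.2 hT⟩)) * Real.exp (l * t) by
    simp only [expPerturb, IccExtend, Function.comp_apply]; ring, abs_mul, Real.abs_exp]
  gcongr
  exact (abs_sub _ _).trans (by linarith)

end expPerturb

theorem hyers_ulam_stability_FDDE
    (α h T L : ℝ) (hα0 : 0 < α) (hα1 : α < 1) (hh : 0 ≤ h) (hT : 0 < T) (hL : 0 < L)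
    (f : ℝ → ℝ → ℝ → ℝ) (g : ℝ → ℝ)
    (hf : ContinuousOn (fun p : ℝ × ℝ × ℝ => f p.1 p.2.1 p.2.2)
      (Set.Icc 0 T ×ˢ (Set.univ : Set (ℝ × ℝ))))
    (hg : ContinuousOn g (Set.Icc 0 T))
    (hgmem : ∀ t ∈ Set.Icc (0:ℝ) T, g t ∈ Set.Icc (-h) T)
    (hgle : ∀ t ∈ Set.Icc (0:ℝ) T, g t ≤ t)
    (hLip : ∀ t ∈ Set.Icc (0:ℝ) T, ∀ υ₁ υ₂ ϑ₁ ϑ₂ : ℝ,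
      |f t υ₁ ϑ₁ - f t υ₂ ϑ₂| ≤ L * (|υ₁ - υ₂| + |ϑ₁ - ϑ₂|)) :
    ∃ c : ℝ, 0 < c ∧
      ∀ ε : ℝ, 0 < ε →
        ∀ ϑ : ℝ → ℝ, ContinuousOn ϑ (Set.Icc (-h) T) →
          (∀ t ∈ Set.Icc (0:ℝ) T,
            |ϑ t - ϑ 0 - (1 / Real.Gamma α) *
              ∫ s in (0:ℝ)..t, (t - s) ^ (α - 1) * f s (ϑ s) (ϑ (g s))| ≤
              ε * T ^ α / Real.Gamma (α + 1)) →
          ∃ υ : ℝ → ℝ, ContinuousOn υ (Set.Icc (-h) T) ∧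
            Set.EqOn υ ϑ (Set.Icc (-h) 0) ∧
            (∀ t ∈ Set.Icc (0:ℝ) T, υ t = ϑ 0 +
              (1 / Real.Gamma α) *
                ∫ s in (0:ℝ)..t, (t - s) ^ (α - 1) * f s (υ s) (υ (g s))) ∧
            ∀ t ∈ Set.Icc (-h) T, |ϑ t - υ t| ≤ c * ε := by
  have hT' := hT.le
  have hΓ := Real.Gamma_pos_of_pos (show 0 < α + 1 by linarith)
  obtain ⟨l, hl, hlα⟩ : ∃ l : ℝ, 0 < l ∧ (1 / l) ^ α = 1 / (8 * L) := by
    refine ⟨(8 * L) ^ (1 / α), by positivity, ?_⟩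
    rw [Real.div_rpow zero_le_one (by positivity), Real.one_rpow, ← Real.rpow_mul (by positivity),
      one_div_mul_cancel hα0.ne', Real.rpow_one]
  refine ⟨4 * (T ^ α / Real.Gamma (α + 1)) * Real.exp (l * T), by positivity,
    fun ε hε ϑ hϑ hres => ?_⟩
  have hsub : Icc 0 T ⊆ Icc (-h) T := Icc_subset_Icc_left (by linarith)
  let u := expPerturb hT' l ϑ
  have hu (z) : ContinuousOn (u z) (Icc (-h) T) := hϑ.expPerturb hT' l z
  let φ (z : C(Icc (0:ℝ) T, ℝ)) (s : ℝ) : ℝ := f s (u z s) (u z (g s))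
  have hφ (z) : ContinuousOn (φ z) (Icc 0 T) :=
    hf.comp (continuousOn_id.prodMk (((hu z).mono hsub).prodMk ((hu z).comp hg hgmem)))
      fun s hs => ⟨hs, mem_univ _⟩
  let R (z : C(Icc (0:ℝ) T, ℝ)) (t : ℝ) : ℝ :=
    Real.exp (-(l * t)) * (ϑ 0 + riemannLiouville α (φ z) t - ϑ t)
  have hR (z) : ContinuousOn (R z) (Icc 0 T) := by
    have h1 := continuousOn_riemannLiouville hα0 hT' (hφ z)
    have h2 := hϑ.mono hsub
    fun_prop
  let P (z : C(Icc (0:ℝ) T, ℝ)) : C(Icc (0:ℝ) T, ℝ) := ⟨(Icc 0 T).domRestrict (R z), (hR z).domRestrict⟩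
  have hφsub (z w) (s : ℝ) (hs : s ∈ Icc 0 T) :
      |φ z s - φ w s| ≤ 4 * L * dist z w * Real.exp (l * s) := by
    have h1 := abs_expPerturb_sub_le hT' l ϑ z w s
    have h2 : |u z (g s) - u w (g s)| ≤ 2 * dist z w * Real.exp (l * s) :=
      (abs_expPerturb_sub_le hT' l ϑ z w (g s)).trans (by gcongr; exact hgle s hs)
    calc _ ≤ L * (|u z s - u w s| + |u z (g s) - u w (g s)|) := hLip s hs _ _ _ _
      _ ≤ L * (2 * dist z w * Real.exp (l * s) + 2 * dist z w * Real.exp (l * s)) := by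
        gcongr
      _ = _ := by ring
  have hP : ContractingWith (1 / 2) P := by
    refine ⟨NNReal.half_lt_self one_ne_zero,
      LipschitzWith.of_dist_le_mul fun z w => ?_⟩
    refine (ContinuousMap.dist_le (by positivity)).2 fun ⟨t, ht⟩ => ?_
    have hsubt : Icc 0 t ⊆ Icc 0 T := Icc_subset_Icc_right ht.2
    have hb := abs_riemannLiouville_sub_le hα0 hl ht.1
      (show 0 ≤ 4 * L * dist z w by positivity) ((hφ z).mono hsubt) ((hφ w).mono hsubt)
      fun s hs => hφsub z w s (hsubt hs)
    rw [hlα] at hb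
    change dist (R z t) (R w t) ≤ _
    rw [Real.dist_eq, show R z t - R w t = Real.exp (-(l * t)) *
      (riemannLiouville α (φ z) t - riemannLiouville α (φ w) t) by simp only [R]; ring,
      abs_mul, Real.abs_exp]
    calc _ ≤ Real.exp (-(l * t)) * (4 * L * dist z w * (1 / (8 * L)) * Real.exp (l * t)) := by
          gcongr
      _ = (Real.exp (-(l * t)) * Real.exp (l * t)) * (1 / 2 * dist z w) := by
          field_simp; ring
      _ = _ := by rw [← Real.exp_add]; simp
  obtain ⟨z, hz⟩ : ∃ z, P z = z := ⟨_, hP.fixedPoint_isFixedPt⟩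
  have hP0 : dist 0 (P 0) ≤ ε * T ^ α / Real.Gamma (α + 1) := by
    refine (ContinuousMap.dist_le (by positivity)).2 fun ⟨t, ht⟩ => ?_
    have hφ0 : φ 0 = fun s => f s (ϑ s) (ϑ (g s)) := by
      simp only [φ, u, expPerturb_zero]
    have h1 : Real.exp (-(l * t)) ≤ 1 := Real.exp_le_one_iff.2 (by have := ht.1; nlinarith)
    change dist 0 (R 0 t) ≤ _
    rw [dist_comm, Real.dist_eq, sub_zero, abs_mul, Real.abs_exp]
    refine (mul_le_of_le_one_left (abs_nonneg _) h1).trans ?_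
    rw [hφ0, abs_sub_comm, ← sub_sub]
    exact hres t ht
  have hz0 : dist z 0 ≤ 2 * (ε * T ^ α / Real.Gamma (α + 1)) := by
    have h1 := hP.toLipschitzWith.dist_le_mul z 0
    have h2 := dist_triangle z (P 0) 0
    rw [hz] at h1
    rw [dist_comm (P 0)] at h2
    push_cast at h1
    linarith
  have hzR (t) (ht : t ∈ Icc 0 T) : z ⟨t, ht⟩ = R z t := by
    conv_lhs => rw [← hz]
    rfl
  have hzzero : z ⟨0, left_mem_Icc.2 hT'⟩ = 0 := by
    rw [hzR]
    simp [R, riemannLiouville]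
  refine ⟨u z, hu z, fun t ht => expPerturb_of_nonpos hT' l ϑ z ht.2, fun t ht => ?_,
    fun t ht => ?_⟩
  · change ϑ t + Real.exp (l * t) * (IccExtend hT' z t - _) = ϑ 0 + riemannLiouville α (φ z) t
    rw [hzzero, IccExtend_of_mem hT' z ht, hzR, sub_zero, ← mul_assoc, ← Real.exp_add]
    simp
  · have h1 := abs_expPerturb_sub_le hT' l ϑ z 0 t
    rw [expPerturb_zero] at h1
    rw [abs_sub_comm]
    calc _ ≤ 2 * dist z 0 * Real.exp (l * t) := h1
      _ ≤ 2 * (2 * (ε * T ^ α / Real.Gamma (α + 1))) * Real.exp (l * T) := by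
        gcongr
        exact ht.2
      _ = _ := by ring
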